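/- arXiv:2510.24201 — 3 statements merged into one kernel-verified Lean document; each statement's English description precedes it below -/
import Mathlib

section
/- Let Z be a group and θ : Z → ℂ× a group homomorphism such that the set {γ ∘ θ : γ ∈ Aut(ℂ/ℚ̄)} of composed homomorphisms is finite. Then θ takes values in ℚ̄×. -/
/-!
STATEMENT 9: Let Z be a group and θ : Z → ℂ× a group homomorphism such that the set
{γ ∘ θ : γ ∈ Aut(ℂ/ℚ̄)} of composed homomorphisms is finite.  Then θ takes values in ℚ̄×.
-/

/-- `ℚ̄`, the algebraic closure of `ℚ` inside `ℂ`. -/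
noncomputable def Qbar : IntermediateField ℚ ℂ := algebraicClosure ℚ ℂ

open Cardinal in
theorem mk_Qbar_le_aleph0 : #Qbar ≤ ℵ₀ := by
  have : Algebra.IsAlgebraic ℚ Qbar := algebraicClosure.isAlgebraic ℚ ℂ
  simpa using Algebra.IsAlgebraic.cardinalMk_le_max ℚ Qbar

theorem transcendental_of_notMem_Qbar {x : ℂ} (hx : x ∉ Qbar) : Transcendental Qbar x := by
  have : Algebra.IsAlgebraic ℚ Qbar := algebraicClosure.isAlgebraic ℚ ℂ
  exact fun h => hx (mem_algebraicClosure_iff.2 (h.restrictScalars ℚ))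

/-- A bijection between transcendence bases of algebraically closed extensions of `R` extends to
an `R`-algebra isomorphism. -/
theorem IsTranscendenceBasis.exists_algEquiv {R K L ι : Type*} [CommRing R] [Field K] [Field L]
    [Algebra R K] [Algebra R L] [IsAlgClosed K] [IsAlgClosed L] {v : ι → K} {w : ι → L}
    (hv : IsTranscendenceBasis R v) (hw : IsTranscendenceBasis R w) :
    ∃ e : K ≃ₐ[R] L, ∀ i, e (v i) = w i := by
  have := IsAlgClosed.isAlgClosure_of_transcendence_basis v hv
  have := IsAlgClosed.isAlgClosure_of_transcendence_basis w hw
  let f : Algebra.adjoin R (Set.range v) ≃ₐ[R] Algebra.adjoin R (Set.range w) :=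
    hv.1.aevalEquiv.symm.trans hw.1.aevalEquiv
  have hf (p : MvPolynomial ι R) :
      IsAlgClosure.equivOfEquiv K L f.toRingEquiv (MvPolynomial.aeval v p) =
        MvPolynomial.aeval w p := by
    rw [← hv.1.algebraMap_aevalEquiv, IsAlgClosure.equivOfEquiv_algebraMap,
      ← hw.1.algebraMap_aevalEquiv]
    simp [f]
  refine ⟨AlgEquiv.ofRingEquiv (f := IsAlgClosure.equivOfEquiv K L f.toRingEquiv) fun r => ?_,
    fun i => ?_⟩
  · simpa using hf (MvPolynomial.C r)
  · simpa using hf (MvPolynomial.X i)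

open Cardinal in
/-- Over a countable base, a transcendental element of an uncountable algebraically closed field
has infinitely many conjugates. -/
theorem Transcendental.infinite_range_algEquiv {F K : Type*} [Field F] [Field K] [Algebra F K]
    [IsAlgClosed K] (hF : #F ≤ ℵ₀) (hK : ℵ₀ < #K) {x : K} (hx : Transcendental F x) :
    (Set.range fun e : K ≃ₐ[F] K => e x).Infinite := by
  classical
  obtain ⟨t, hxt, ht⟩ := exists_isTranscendenceBasis_superset (R := F) (s := {x})
    ((algebraicIndependent_unique_type_iff (ι := ({x} : Set K))).2 hx)
  have hxt : x ∈ t := hxt rfl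
  have hcard : #K = #t := by
    simpa using IsAlgClosed.cardinal_eq_cardinal_transcendence_basis_of_aleph0_lt _ ht hF hK
  have hinf : t.Infinite := by
    rw [← Set.infinite_coe_iff, Cardinal.infinite_iff, ← hcard]
    exact hK.le
  refine hinf.mono fun y hy => ?_
  obtain ⟨e, he⟩ := ht.exists_algEquiv
    (ht.comp_equiv (Equiv.swap (⟨x, hxt⟩ : t) ⟨y, hy⟩))
  exact ⟨e, by simpa using he ⟨x, hxt⟩⟩

theorem stmt_9 (Z : Type*) [Group Z] (θ : Z →* ℂˣ)
    (h : {θ' : Z →* ℂˣ | ∃ γ : ℂ ≃+* ℂ, (∀ x ∈ Qbar, γ x = x) ∧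
        θ' = (Units.map (γ : ℂ →* ℂ)).comp θ}.Finite) :
    ∀ z : Z, ((θ z : ℂˣ) : ℂ) ∈ Qbar := by
  intro z
  by_contra hz
  refine (transcendental_of_notMem_Qbar hz).infinite_range_algEquiv mk_Qbar_le_aleph0
    (by simpa using Cardinal.aleph0_lt_continuum) ?_
  refine (h.image fun θ' => ((θ' z : ℂˣ) : ℂ)).subset ?_
  rintro _ ⟨e, rfl⟩
  exact ⟨_, ⟨e.toRingEquiv, fun x hx => e.commutes ⟨x, hx⟩, rfl⟩, rfl⟩
end

section
/- Let R be a finite group, V a nonzero complex vector space, J : R → GL(V) a map, and ν : R × R → ℂ× a function such that J(r)J(s) = ν(r,s) J(rs) for all r, s ∈ R. Then there exists a function c : R → ℂ× such that, setting J'(r) = c(r)J(r), every operator J'(r) has finite order in GL(V), and the rescaled cocycle ν'(r,s) = c(r)c(s)c(rs)⁻¹ ν(r,s) takes only values that are roots of unity. -/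
/-!
STATEMENT 12: Let R be a finite group, V a nonzero complex vector space, J : R → GL(V) a map,
and ν : R × R → ℂ× a function such that J(r)J(s) = ν(r,s) J(rs) for all r, s ∈ R.  Then there
exists a function c : R → ℂ× such that, setting J'(r) = c(r)J(r), every operator J'(r) has
finite order in GL(V), and the rescaled cocycle ν'(r,s) = c(r)c(s)c(rs)⁻¹ ν(r,s) takes only
values that are roots of unity.
-/

/-- The multiplier of a projective representation on a nontrivial space is a 2-cocycle. -/
theorem multiplier_cocycle {R V : Type*} [Group R] [AddCommGroup V] [Module ℂ V] [Nontrivial V]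
    (J : R → (V ≃ₗ[ℂ] V)) (ν : R → R → ℂˣ)
    (hJ : ∀ r s : R, (J r).toLinearMap * (J s).toLinearMap
      = (ν r s : ℂ) • (J (r * s)).toLinearMap) (r s t : R) :
    ν r s * ν (r * s) t = ν s t * ν r (s * t) := by
  obtain ⟨v, hv⟩ := exists_ne (0 : V)
  have h := mul_assoc (J r).toLinearMap (J s).toLinearMap (J t).toLinearMap
  rw [hJ r s, hJ s t, smul_mul_assoc, mul_smul_comm, hJ, hJ, smul_smul, smul_smul,
    mul_assoc r s t] at h
  have h' := LinearMap.congr_fun h v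
  have hne : J (r * (s * t)) v ≠ 0 := by simpa using hv
  exact Units.ext (smul_left_injective ℂ hne (by simpa using h'))

/-- A complex-valued 2-cocycle on a finite group can be rescaled by a coboundary so that its
values are roots of unity of order dividing the order of the group. -/
theorem exists_rescale_cocycle_pow_card {R : Type*} [Group R] [Finite R] (ν : R → R → ℂˣ)
    (hν : ∀ r s t, ν r s * ν (r * s) t = ν s t * ν r (s * t)) :
    ∃ c : R → ℂˣ, ∀ r s, (c r * c s * (c (r * s))⁻¹ * ν r s) ^ Nat.card R = 1 := by
  have := Fintype.ofFinite R
  have hroot (z : ℂˣ) : ∃ w : ℂˣ, w ^ Nat.card R = z := by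
    obtain ⟨w, hw⟩ := IsAlgClosed.exists_pow_nat_eq (z : ℂ) (Nat.card_pos (α := R))
    have hw0 : w ≠ 0 := by
      rintro rfl
      rw [zero_pow Nat.card_pos.ne'] at hw
      exact z.ne_zero hw.symm
    exact ⟨Units.mk0 w hw0, Units.ext (by simpa using hw)⟩
  choose c hc using fun r => hroot (∏ t, ν r t)⁻¹
  refine ⟨c, fun r s => ?_⟩
  have hprod : ν r s ^ Nat.card R * ∏ t, ν (r * s) t = (∏ t, ν s t) * ∏ t, ν r t := by
    have h := Finset.prod_congr (rfl : (Finset.univ : Finset R) = _) fun t _ => hν r s t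
    rw [Finset.prod_mul_distrib, Finset.prod_mul_distrib,
      Fintype.prod_equiv (Equiv.mulLeft s) (fun t => ν r (s * t)) (ν r) fun _ => rfl] at h
    simpa [Nat.card_eq_fintype_card] using h
  rw [mul_pow, mul_pow, mul_pow, inv_pow, hc, hc, hc, inv_inv, mul_assoc,
    mul_comm (∏ t, ν (r * s) t), hprod]
  rw [mul_comm (∏ t, ν s t), ← mul_inv, inv_mul_cancel]

/-- A projective representation of a finite group whose multiplier takes values in the `n`-th
roots of unity, for some `n > 0`, consists of operators of finite order. -/
theorem projective_pow_eq_one {R A : Type*} [Group R] [Ring A] [Algebra ℂ A]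
    (P : R → A) (hunit : IsUnit (P 1)) (μ : R → R → ℂˣ)
    (hP : ∀ r s, P r * P s = (μ r s : ℂ) • P (r * s)) {n : ℕ}
    (hμ : ∀ r s, μ r s ^ n = 1) (r : R) : P r ^ (Nat.card R * n) = 1 := by
  have hone : P 1 = (μ 1 1 : ℂ) • 1 := by
    apply hunit.mul_left_cancel
    rw [hP, mul_one, mul_smul_comm, mul_one]
  have hpow (k : ℕ) : ∃ z : ℂˣ, z ^ n = 1 ∧ P r ^ k = (z : ℂ) • P (r ^ k) := by
    induction k with
    | zero => exact ⟨(μ 1 1)⁻¹, by simp [hμ], by simp [hone, smul_smul]⟩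
    | succ k ih =>
      obtain ⟨z, hz, h⟩ := ih
      exact ⟨z * μ (r ^ k) r, by simp [mul_pow, hz, hμ],
        by rw [pow_succ, h, smul_mul_assoc, hP, smul_smul, ← pow_succ, Units.val_mul]⟩
  obtain ⟨z, hz, h⟩ := hpow (Nat.card R)
  have hroot : (z * μ 1 1) ^ n = 1 := by rw [mul_pow, hz, hμ, mul_one]
  rw [pow_mul, h, pow_card_eq_one', hone, smul_smul, smul_pow, one_pow, ← Units.val_mul,
    ← Units.val_pow_eq_pow_val, hroot, Units.val_one, one_smul]

theorem stmt_12 (R : Type*) [Group R] [Finite R]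
    (V : Type*) [AddCommGroup V] [Module ℂ V] (hV : ∃ v : V, v ≠ 0)
    (J : R → (V ≃ₗ[ℂ] V)) (ν : R → R → ℂˣ)
    (hJ : ∀ r s : R, (J r).toLinearMap * (J s).toLinearMap
      = (ν r s : ℂ) • (J (r * s)).toLinearMap) :
    ∃ c : R → ℂˣ,
      (∀ r : R, ∃ m : ℕ, 0 < m ∧ ((c r : ℂ) • (J r).toLinearMap) ^ m = 1) ∧
      (∀ r s : R, ∃ m : ℕ, 0 < m ∧ (c r * c s * (c (r * s))⁻¹ * ν r s) ^ m = 1) := by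
  have : Nontrivial V := nontrivial_of_ne _ _ hV.choose_spec
  obtain ⟨c, hc⟩ := exists_rescale_cocycle_pow_card ν (multiplier_cocycle J ν hJ)
  refine ⟨c, fun r => ⟨Nat.card R * Nat.card R, Nat.mul_pos Nat.card_pos Nat.card_pos, ?_⟩,
    fun r s => ⟨Nat.card R, Nat.card_pos, hc r s⟩⟩
  refine projective_pow_eq_one (fun r => (c r : ℂ) • (J r).toLinearMap) ?_ _ (fun r s => ?_) hc r
  · exact IsUnit.smul (c 1) ((Module.End.isUnit_iff _).2 (J 1).bijective)
  · rw [smul_mul_assoc, mul_smul_comm, hJ, smul_smul, smul_smul, smul_smul]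
    congr 1
    push_cast
    field_simp
end

section
/- Let R be a unital associative ring. Suppose that to every left R-module V there are assigned R-submodules V₁ and V₂ such that V = V₁ ⊕ V₂ (internal direct sum), functorially in the sense that for every homomorphism f : V → W of left R-modules one has f(V₁) ⊆ W₁ and f(V₂) ⊆ W₂. Let R₁ and R₂ denote the submodules assigned to the left regular module R. Then R₁ and R₂ are two-sided ideals of R with R = R₁ ⊕ R₂, and for every left R-module V one has R₁V = V₁ and R₂V = V₂. Moreover, R₁ and R₂ form the unique decomposition of R as a direct sum of two two-sided ideals with the properties R₁V = V₁ and R₂V = V₂ for all V. -/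
/-!
STATEMENT 13: Let R be a unital associative ring.  Suppose that to every left R-module V there
are assigned R-submodules V₁ and V₂ such that V = V₁ ⊕ V₂ (internal direct sum), functorially
in the sense that every homomorphism f : V → W of left R-modules satisfies f(V₁) ⊆ W₁ and
f(V₂) ⊆ W₂.  Let R₁ and R₂ denote the submodules assigned to the left regular module R.  Then
R₁ and R₂ are two-sided ideals of R with R = R₁ ⊕ R₂, and for every left R-module V one has
R₁V = V₁ and R₂V = V₂.  Moreover, R₁ and R₂ form the unique decomposition of R as a direct sum
of two two-sided ideals with these properties.
-/

universe u

/-- If `I + J = R`, `I V ⊆ A`, `J V ⊆ B` and `A ∩ B = 0`, then `I V = A`. -/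
theorem span_smul_eq_of_codisjoint_of_disjoint {R V : Type*} [Ring R] [AddCommGroup V]
    [Module R V] {I J : Submodule R R} {A B : Submodule R V} (hIJ : Codisjoint I J)
    (hAB : Disjoint A B) (hA : ∀ a ∈ I, ∀ v : V, a • v ∈ A) (hB : ∀ b ∈ J, ∀ v : V, b • v ∈ B) :
    Submodule.span R {x : V | ∃ a ∈ I, ∃ v : V, x = a • v} = A := by
  refine le_antisymm (Submodule.span_le.2 ?_) fun v hv => ?_
  · rintro _ ⟨a, ha, v, rfl⟩
    exact hA a ha v
  · obtain ⟨e, he, f, hf, hef⟩ := Submodule.mem_sup.1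
      (hIJ.eq_top.symm ▸ Submodule.mem_top : (1 : R) ∈ I ⊔ J)
    have hsum : e • v + f • v = v := by rw [← add_smul, hef, one_smul]
    have hfv : f • v ∈ A := by
      rw [eq_sub_of_add_eq' hsum]
      exact A.sub_mem hv (hA e he v)
    have hzero : f • v = 0 := Submodule.disjoint_def.1 hAB _ hfv (hB f hf v)
    rw [hzero, add_zero] at hsum
    exact Submodule.subset_span ⟨e, he, v, hsum.symm⟩

/-- A left ideal `J` closed under right multiplication satisfies `J R = J`. -/
theorem span_smul_self_eq_of_mul_mem {R : Type*} [Ring R] {J : Submodule R R}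
    (hJ : ∀ a ∈ J, ∀ r : R, a * r ∈ J) :
    Submodule.span R {x : R | ∃ a ∈ J, ∃ v : R, x = a • v} = J := by
  refine le_antisymm (Submodule.span_le.2 ?_) fun a ha =>
    Submodule.subset_span ⟨a, ha, 1, by simp⟩
  rintro _ ⟨a, ha, r, rfl⟩
  exact hJ a ha r

theorem stmt_13 (R : Type u) [Ring R]
    (s₁ s₂ : ∀ (V : Type u) [AddCommGroup V] [Module R V], Submodule R V)
    (hcompl : ∀ (V : Type u) [AddCommGroup V] [Module R V], IsCompl (s₁ V) (s₂ V))
    (hfunc₁ : ∀ (V W : Type u) [AddCommGroup V] [Module R V] [AddCommGroup W] [Module R W]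
      (f : V →ₗ[R] W), Submodule.map f (s₁ V) ≤ s₁ W)
    (hfunc₂ : ∀ (V W : Type u) [AddCommGroup V] [Module R V] [AddCommGroup W] [Module R W]
      (f : V →ₗ[R] W), Submodule.map f (s₂ V) ≤ s₂ W) :
    -- `R₁ = s₁ R` and `R₂ = s₂ R` are two-sided ideals
    ((∀ a ∈ s₁ R, ∀ r : R, a * r ∈ s₁ R) ∧ (∀ a ∈ s₂ R, ∀ r : R, a * r ∈ s₂ R)) ∧
    -- `R = R₁ ⊕ R₂`
    IsCompl (s₁ R) (s₂ R) ∧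
    -- `R₁ V = V₁` and `R₂ V = V₂` for every left `R`-module `V`
    (∀ (V : Type u) [AddCommGroup V] [Module R V],
      Submodule.span R {x : V | ∃ a ∈ s₁ R, ∃ v : V, x = a • v} = s₁ V ∧
      Submodule.span R {x : V | ∃ a ∈ s₂ R, ∃ v : V, x = a • v} = s₂ V) ∧
    -- uniqueness of the decomposition
    (∀ J₁ J₂ : Submodule R R,
      (∀ a ∈ J₁, ∀ r : R, a * r ∈ J₁) → (∀ a ∈ J₂, ∀ r : R, a * r ∈ J₂) →
      IsCompl J₁ J₂ →
      (∀ (V : Type u) [AddCommGroup V] [Module R V],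
        Submodule.span R {x : V | ∃ a ∈ J₁, ∃ v : V, x = a • v} = s₁ V ∧
        Submodule.span R {x : V | ∃ a ∈ J₂, ∃ v : V, x = a • v} = s₂ V) →
      J₁ = s₁ R ∧ J₂ = s₂ R) := by
  have smul_mem₁ : ∀ (V : Type u) [AddCommGroup V] [Module R V], ∀ a ∈ s₁ R, ∀ v : V,
      a • v ∈ s₁ V := fun V _ _ a ha v =>
    hfunc₁ R V (LinearMap.toSpanSingleton R V v) ⟨a, ha, rfl⟩
  have smul_mem₂ : ∀ (V : Type u) [AddCommGroup V] [Module R V], ∀ a ∈ s₂ R, ∀ v : V,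
      a • v ∈ s₂ V := fun V _ _ a ha v =>
    hfunc₂ R V (LinearMap.toSpanSingleton R V v) ⟨a, ha, rfl⟩
  refine ⟨⟨smul_mem₁ R, smul_mem₂ R⟩, hcompl R, fun V _ _ => ⟨?_, ?_⟩,
    fun J₁ J₂ hJ₁ hJ₂ _ hJ => ⟨?_, ?_⟩⟩
  · exact span_smul_eq_of_codisjoint_of_disjoint (hcompl R).codisjoint (hcompl V).disjoint
      (smul_mem₁ V) (smul_mem₂ V)
  · exact span_smul_eq_of_codisjoint_of_disjoint (hcompl R).symm.codisjoint
      (hcompl V).symm.disjoint (smul_mem₂ V) (smul_mem₁ V)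
  · exact (span_smul_self_eq_of_mul_mem hJ₁).symm.trans (hJ R).1
  · exact (span_smul_self_eq_of_mul_mem hJ₂).symm.trans (hJ R).2
end
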